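/- For integers m, n let A_{m,n} be the 6×6 integer matrix with rows (2,0,0,0,0,0), (−1,2,0,0,0,0), (0,−1,−1,0,0,0), (0,0,−1,−1,0,0), (0,0,0,−1,−m,0), (0,0,0,0,−1,n), and for ω ∈ (0,1/2) let B_{m,n,ω} := (1 − e^{4πiω})·A_{m,n} + (1 − e^{−4πiω})·A_{m,n}^T, a Hermitian matrix over ℂ. Then: (1) for all integers m ≥ 1 and n ≥ 0, det B_{m,n,1/4} = −64·(53 + 4(53m − 17)n) < 0 and B_{m,n,1/4} has exactly three positive and three negative eigenvalues; and (2) for all integers m ≥ 7, n ≥ 0 and all real ω ∈ (0,1/2), det B_{m,n,ω} < 0 and B_{m,n,ω} has exactly three positive and three negative eigenvalues, i.e. its signature (number of positive minus number of negative eigenvalues) is zero. -/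

import Mathlib

open Complex Matrix
open scoped Classical

noncomputable section

/-- The Seifert matrix `A_{m,n}` of the two-bridge knot `K_{m,n}`, regarded as a
complex matrix. -/
def Amat (m n : ℤ) : Matrix (Fin 6) (Fin 6) ℂ :=
  !![2, 0, 0, 0, 0, 0;
     -1, 2, 0, 0, 0, 0;
     0, -1, -1, 0, 0, 0;
     0, 0, -1, -1, 0, 0;
     0, 0, 0, -1, -(m : ℂ), 0;
     0, 0, 0, 0, -1, (n : ℂ)]

/-- The Hermitian matrix
`B_{m,n,ω} = (1 - e^{4πiω})·A_{m,n} + (1 - e^{-4πiω})·A_{m,n}ᵀ`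
whose signature computes the Tristram–Levine signature `σ_ω(K_{m,n})`. -/
def Bmat (m n : ℤ) (ω : ℝ) : Matrix (Fin 6) (Fin 6) ℂ :=
  (1 - Complex.exp (4 * Real.pi * Complex.I * (ω : ℂ))) • Amat m n
    + (1 - Complex.exp (-(4 * Real.pi * Complex.I * (ω : ℂ)))) • (Amat m n)ᵀ

/-- The quadratic form of a Hermitian matrix, written in eigencoordinates. -/
lemma Matrix.IsHermitian.re_dotProduct_mulVec_eq_sum {n : Type*} [Fintype n] [DecidableEq n]
    {B : Matrix n n ℂ} (hB : B.IsHermitian) (y : n → ℂ) :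
    (star y ⬝ᵥ B *ᵥ y).re =
      ∑ i, hB.eigenvalues i * normSq ((star (hB.eigenvectorUnitary : Matrix n n ℂ) *ᵥ y) i) := by
  have h : star y ⬝ᵥ B *ᵥ y =
      star (star (hB.eigenvectorUnitary : Matrix n n ℂ) *ᵥ y) ⬝ᵥ
        diagonal (RCLike.ofReal ∘ hB.eigenvalues) *ᵥ
          (star (hB.eigenvectorUnitary : Matrix n n ℂ) *ᵥ y) := by
    conv_lhs => rw [hB.spectral_theorem, Unitary.conjStarAlgAut_apply]
    simp [star_mulVec, star_eq_conjTranspose, dotProduct_mulVec, vecMul_vecMul, Matrix.mul_assoc]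
  rw [h, dotProduct, re_sum]
  refine Finset.sum_congr rfl fun i _ => ?_
  simp [mulVec_diagonal, normSq_apply]
  ring

/-- If `c` times the quadratic form of a Hermitian matrix is positive definite on the range of
a matrix with `k` columns, then at least `k` eigenvalues have the sign of `c`. -/
lemma Matrix.IsHermitian.le_card_eigenvalues_of_definite {n : Type*} [Fintype n] [DecidableEq n]
    {B : Matrix n n ℂ} (hB : B.IsHermitian) (c : ℝ) {k : ℕ} (P : Matrix n (Fin k) ℂ)
    (hP : ∀ x ≠ 0, 0 < c * (star (P *ᵥ x) ⬝ᵥ B *ᵥ (P *ᵥ x)).re) :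
    k ≤ (Finset.univ.filter fun i => 0 < c * hB.eigenvalues i).card := by
  by_contra! hlt
  let S := Finset.univ.filter fun i => 0 < c * hB.eigenvalues i
  let T : (Fin k → ℂ) →ₗ[ℂ] (S → ℂ) :=
    (LinearMap.funLeft ℂ ℂ ((↑) : S → n)).comp
      (star (hB.eigenvectorUnitary : Matrix n n ℂ) * P).mulVecLin
  have hker : LinearMap.ker T ≠ ⊥ := LinearMap.ker_ne_bot_of_finrank_lt (by simpa using hlt)
  obtain ⟨x, hxT, hx⟩ := Submodule.exists_mem_ne_zero_of_ne_bot hker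
  have hpos := hP x hx
  rw [hB.re_dotProduct_mulVec_eq_sum, Finset.mul_sum] at hpos
  refine hpos.not_ge (Finset.sum_nonpos fun i _ => ?_)
  rw [← mul_assoc]
  by_cases hi : 0 < c * hB.eigenvalues i
  · have hz := congrFun (LinearMap.mem_ker.mp hxT) ⟨i, by simp [S, hi]⟩
    simp only [T, LinearMap.comp_apply, LinearMap.funLeft_apply, mulVecLin_apply,
      Pi.zero_apply, ← mulVec_mulVec] at hz
    simp [hz]
  · exact mul_nonpos_of_nonpos_of_nonneg (not_lt.mp hi) (normSq_nonneg _)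

/-- Six reals with negative product, at least two of them positive and at least two negative,
are three positive and three negative reals. -/
lemma card_pos_neg_of_prod_neg (f : Fin 6 → ℝ) (hprod : ∏ i, f i < 0)
    (hpos : 2 ≤ (Finset.univ.filter fun i => 0 < f i).card)
    (hneg : 2 ≤ (Finset.univ.filter fun i => f i < 0).card) :
    (Finset.univ.filter fun i => 0 < f i).card = 3 ∧
      (Finset.univ.filter fun i => f i < 0).card = 3 := by
  have hne : ∀ i, f i ≠ 0 := fun i =>
    Finset.prod_ne_zero_iff.mp hprod.ne i (Finset.mem_univ i)
  have hcompl : (Finset.univ.filter fun i => ¬ 0 < f i) =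
      Finset.univ.filter fun i => f i < 0 :=
    Finset.filter_congr fun i _ => ⟨fun h => lt_of_le_of_ne (not_lt.mp h) (hne i), fun h => h.not_gt⟩
  have hcard := Finset.card_filter_add_card_filter_not
    (s := (Finset.univ : Finset (Fin 6))) (fun i => 0 < f i)
  have hsplit := Finset.prod_filter_mul_prod_filter_not Finset.univ (fun i => 0 < f i) f
  rw [hcompl] at hcard hsplit
  simp only [Finset.card_univ, Fintype.card_fin] at hcard
  have hP : 0 < ∏ i with 0 < f i, f i :=
    Finset.prod_pos fun i hi => (Finset.mem_filter.mp hi).2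
  have hN : 0 < ∏ i with f i < 0, -f i :=
    Finset.prod_pos fun i hi => neg_pos.mpr (Finset.mem_filter.mp hi).2
  rw [Finset.prod_neg] at hN
  have hodd : ¬ Even (Finset.univ.filter fun i => f i < 0).card := fun he => by
    rw [he.neg_one_pow, one_mul] at hN
    exact (hsplit ▸ mul_pos hP hN).not_gt hprod
  rcases (by omega : (Finset.univ.filter fun i => f i < 0).card = 2 ∨
    (Finset.univ.filter fun i => f i < 0).card = 3 ∨
    (Finset.univ.filter fun i => f i < 0).card = 4) with h | h | h
  · exact absurd (h ▸ by decide) hodd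
  · omega
  · exact absurd (h ▸ by decide) hodd

/-- The Hermitian matrix `w A + w̄ Aᵀ` attached to the Seifert matrix. -/
def hermitianForm (m n : ℤ) (w : ℂ) : Matrix (Fin 6) (Fin 6) ℂ :=
  w • Amat m n + star w • (Amat m n)ᵀ

lemma isHermitian_hermitianForm (m n : ℤ) (w : ℂ) : (hermitianForm m n w).IsHermitian := by
  have hA : (Amat m n)ᴴ = (Amat m n)ᵀ := by
    ext i j
    fin_cases i <;> fin_cases j <;> simp [Amat, conjTranspose_apply]
  have hA' : (Amat m n)ᵀᴴ = Amat m n := by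
    rw [← hA, conjTranspose_conjTranspose]
  simp [hermitianForm, Matrix.IsHermitian, hA, hA', add_comm]

/-- On the circle `w + w̄ = |w|²` the form is tridiagonal, with diagonal a multiple of `|w|²`. -/
lemma hermitianForm_eq {m n : ℤ} {w s : ℂ} (h : w + star w = s) :
    hermitianForm m n w =
      !![2 * s, -star w, 0, 0, 0, 0;
         -w, 2 * s, -star w, 0, 0, 0;
         0, -w, -s, -star w, 0, 0;
         0, 0, -w, -s, -star w, 0;
         0, 0, 0, -w, -m * s, -star w;
         0, 0, 0, 0, -w, n * s] := by
  subst h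
  ext i j
  fin_cases i <;> fin_cases j <;> simp [hermitianForm, Amat] <;> ring

lemma det_tridiagonal (a b c d e f u v : ℂ) :
    (!![a, u, 0, 0, 0, 0;
        v, b, u, 0, 0, 0;
        0, v, c, u, 0, 0;
        0, 0, v, d, u, 0;
        0, 0, 0, v, e, u;
        0, 0, 0, 0, v, f] : Matrix (Fin 6) (Fin 6) ℂ).det =
      f * (e * (d * (c * (a * b - u * v) - u * v * a) - u * v * (a * b - u * v))
          - u * v * (c * (a * b - u * v) - u * v * a))
        - u * v * (d * (c * (a * b - u * v) - u * v * a) - u * v * (a * b - u * v)) := by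
  simp [det_succ_row_zero, Fin.sum_univ_succ, Fin.succAbove]
  ring

lemma det_hermitianForm {m n : ℤ} {w : ℂ} {s : ℝ} (hadd : w + star w = s)
    (hmul : w * star w = s) :
    (hermitianForm m n w).det =
      ((s ^ 3 * (n * s * (4 * s + 1 - m * (4 * s ^ 2 - 3 * s + 1))
        - (4 * s ^ 2 - 3 * s + 1)) : ℝ) : ℂ) := by
  have huv : -star w * -w = s := by rw [← hmul]; ring
  rw [hermitianForm_eq hadd, det_tridiagonal, huv]
  push_cast
  ring

lemma det_hermitianForm_factor_neg {n : ℤ} {M s : ℝ} (hn : 0 ≤ n) (hs : 0 < s)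
    (hM : 4 * s + 1 < M * (4 * s ^ 2 - 3 * s + 1)) :
    s ^ 3 * (n * s * (4 * s + 1 - M * (4 * s ^ 2 - 3 * s + 1))
      - (4 * s ^ 2 - 3 * s + 1)) < 0 := by
  have hq : 0 < 4 * s ^ 2 - 3 * s + 1 := by nlinarith [sq_nonneg (8 * s - 3)]
  have hn' : (0 : ℝ) ≤ n := by exact_mod_cast hn
  have : n * s * (4 * s + 1 - M * (4 * s ^ 2 - 3 * s + 1)) ≤ 0 :=
    mul_nonpos_of_nonneg_of_nonpos (by positivity) (by linarith)
  exact mul_neg_of_pos_of_neg (by positivity) (by linarith)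

lemma fin_two_normSq_combination_pos {α β : ℝ} (hα : 0 < α) (hβ : 0 < β) {x : Fin 2 → ℂ}
    (hx : x ≠ 0) : 0 < α * normSq (x 0) + β * normSq (x 1) := by
  have h0 := normSq_nonneg (x 0)
  have h1 := normSq_nonneg (x 1)
  by_cases hx0 : x 0 = 0
  · have hx1 : x 1 ≠ 0 := fun h => hx (by ext i; fin_cases i <;> simp [hx0, h])
    have := normSq_pos.mpr hx1
    positivity
  · have := normSq_pos.mpr hx0
    positivity

lemma two_le_card_pos_eigenvalues {m n : ℤ} {w : ℂ} {s : ℝ} (hadd : w + star w = s)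
    (hmul : w * star w = s) (hs : 0 < s) (hm : 1 ≤ m) (hn : 0 ≤ n) :
    2 ≤ (Finset.univ.filter fun i : Fin 6 =>
      0 < (isHermitian_hermitianForm m n w).eigenvalues i).card := by
  have hm' : (1 : ℝ) ≤ m := by exact_mod_cast hm
  have hn' : (0 : ℝ) ≤ n := by exact_mod_cast hn
  have key := (isHermitian_hermitianForm m n w).le_card_eigenvalues_of_definite 1
    (k := 2) !![1, 0; 0, 0; 0, 0; 0, 0; 0, 1; 0, -m * w] fun x hx => ?_
  · simpa using key
  have hval : star ((!![1, 0; 0, 0; 0, 0; 0, 0; 0, 1; 0, -m * w] :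
        Matrix (Fin 6) (Fin 2) ℂ) *ᵥ x) ⬝ᵥ hermitianForm m n w *ᵥ
        ((!![1, 0; 0, 0; 0, 0; 0, 0; 0, 1; 0, -m * w] : Matrix (Fin 6) (Fin 2) ℂ) *ᵥ x) =
      ((2 * s * normSq (x 0) + (m * s + n * m ^ 2 * s ^ 2) * normSq (x 1) : ℝ) : ℂ) := by
    rw [hermitianForm_eq hadd]
    simp only [mulVec, dotProduct, Fin.sum_univ_succ]
    simp [vecHead, vecTail] at hmul ⊢
    simp only [normSq_eq_conj_mul_self]
    linear_combination (starRingEnd ℂ (x 1) * x 1 * (2 * m + n * m ^ 2 * s)) * hmul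
  rw [hval, ofReal_re, one_mul]
  exact fin_two_normSq_combination_pos (by positivity) (by positivity) hx

lemma two_le_card_neg_eigenvalues {m n : ℤ} {w : ℂ} {s : ℝ} (hadd : w + star w = s)
    (hs : 0 < s) (hm : 1 ≤ m) :
    2 ≤ (Finset.univ.filter fun i : Fin 6 =>
      (isHermitian_hermitianForm m n w).eigenvalues i < 0).card := by
  have hm' : (1 : ℝ) ≤ m := by exact_mod_cast hm
  have key := (isHermitian_hermitianForm m n w).le_card_eigenvalues_of_definite (-1)
    (k := 2) !![0, 0; 0, 0; 1, 0; 0, 0; 0, 1; 0, 0] fun x hx => ?_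
  · simpa using key
  have hval : star ((!![0, 0; 0, 0; 1, 0; 0, 0; 0, 1; 0, 0] :
        Matrix (Fin 6) (Fin 2) ℂ) *ᵥ x) ⬝ᵥ hermitianForm m n w *ᵥ
        ((!![0, 0; 0, 0; 1, 0; 0, 0; 0, 1; 0, 0] : Matrix (Fin 6) (Fin 2) ℂ) *ᵥ x) =
      ((-(s * normSq (x 0) + m * s * normSq (x 1)) : ℝ) : ℂ) := by
    rw [hermitianForm_eq hadd]
    simp only [mulVec, dotProduct, Fin.sum_univ_succ]
    simp [vecHead, vecTail]
    simp only [normSq_eq_conj_mul_self]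
    ring
  rw [hval, ofReal_re, neg_one_mul, neg_neg]
  exact fin_two_normSq_combination_pos hs (by positivity) hx

lemma card_eigenvalues_hermitianForm {m n : ℤ} {w : ℂ} {s : ℝ} (hadd : w + star w = s)
    (hmul : w * star w = s) (hs : 0 < s) (hm : 1 ≤ m) (hn : 0 ≤ n)
    (hM : 4 * s + 1 < m * (4 * s ^ 2 - 3 * s + 1)) :
    (Finset.univ.filter fun i : Fin 6 =>
        0 < (isHermitian_hermitianForm m n w).eigenvalues i).card = 3 ∧
      (Finset.univ.filter fun i : Fin 6 =>
        (isHermitian_hermitianForm m n w).eigenvalues i < 0).card = 3 := by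
  refine card_pos_neg_of_prod_neg _ ?_ (two_le_card_pos_eigenvalues hadd hmul hs hm hn)
    (two_le_card_neg_eigenvalues hadd hs hm)
  have hdet := (isHermitian_hermitianForm m n w).det_eq_prod_eigenvalues
  rw [det_hermitianForm hadd hmul] at hdet
  have hreal : s ^ 3 * (n * s * (4 * s + 1 - m * (4 * s ^ 2 - 3 * s + 1))
      - (4 * s ^ 2 - 3 * s + 1)) =
      ∏ i, (isHermitian_hermitianForm m n w).eigenvalues i := by
    refine ofReal_injective (hdet.trans ?_)
    simp
  rw [← hreal]
  exact det_hermitianForm_factor_neg hn hs hM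

lemma Bmat_eq_hermitianForm (m n : ℤ) (ω : ℝ) :
    Bmat m n ω = hermitianForm m n (1 - exp (4 * Real.pi * I * (ω : ℂ))) := by
  have : star (1 - exp (4 * Real.pi * I * (ω : ℂ))) =
      1 - exp (-(4 * Real.pi * I * (ω : ℂ))) := by
    simp [← exp_conj, conj_ofNat]
  rw [Bmat, hermitianForm, this]

lemma one_sub_exp_add_star (ω : ℝ) :
    (1 - exp (4 * Real.pi * I * (ω : ℂ))) + star (1 - exp (4 * Real.pi * I * (ω : ℂ))) =
      ((2 - 2 * Real.cos (4 * Real.pi * ω) : ℝ) : ℂ) := by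
  have harg : 4 * Real.pi * I * (ω : ℂ) = ((4 * Real.pi * ω : ℝ) : ℂ) * I := by
    push_cast; ring
  rw [harg]
  apply Complex.ext
  · simp [exp_ofReal_mul_I_re, -ofReal_mul]; ring
  · simp [-ofReal_mul]

lemma one_sub_exp_mul_star (ω : ℝ) :
    (1 - exp (4 * Real.pi * I * (ω : ℂ))) * star (1 - exp (4 * Real.pi * I * (ω : ℂ))) =
      ((2 - 2 * Real.cos (4 * Real.pi * ω) : ℝ) : ℂ) := by
  rw [← one_sub_exp_add_star]
  have hstar : star (exp (4 * Real.pi * I * (ω : ℂ))) = exp (-(4 * Real.pi * I * (ω : ℂ))) := by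
    simp [← exp_conj, conj_ofNat]
  have h : exp (4 * Real.pi * I * (ω : ℂ)) * exp (-(4 * Real.pi * I * (ω : ℂ))) = 1 := by
    rw [← exp_add, add_neg_cancel, exp_zero]
  rw [star_sub, star_one, hstar]
  linear_combination h

/-- **Statement 19.**  (1) For all integers `m ≥ 1`, `n ≥ 0`,
`det B_{m,n,1/4} = -64·(53 + 4(53m - 17)n) < 0`, the matrix `B_{m,n,1/4}` is Hermitian
and has exactly three positive and three negative eigenvalues.  (2) For all integers
`m ≥ 7`, `n ≥ 0` and all real `ω ∈ (0,1/2)`, `det B_{m,n,ω} < 0`, the matrix is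
Hermitian and has exactly three positive and three negative eigenvalues; i.e. its
signature is zero. -/
theorem statement_19 :
    (∀ m n : ℤ, 1 ≤ m → 0 ≤ n →
      (Bmat m n (1 / 4)).det = (((-64) * (53 + 4 * (53 * m - 17) * n) : ℤ) : ℂ) ∧
      (((-64) * (53 + 4 * (53 * m - 17) * n) : ℤ) : ℝ) < 0 ∧
      ∃ hB : (Bmat m n (1 / 4)).IsHermitian,
        (Finset.univ.filter fun i : Fin 6 => 0 < hB.eigenvalues i).card = 3 ∧
        (Finset.univ.filter fun i : Fin 6 => hB.eigenvalues i < 0).card = 3) ∧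
    (∀ m n : ℤ, 7 ≤ m → 0 ≤ n → ∀ ω : ℝ, 0 < ω → ω < 1 / 2 →
      (∃ r : ℝ, r < 0 ∧ (Bmat m n ω).det = (r : ℂ)) ∧
      ∃ hB : (Bmat m n ω).IsHermitian,
        (Finset.univ.filter fun i : Fin 6 => 0 < hB.eigenvalues i).card = 3 ∧
        (Finset.univ.filter fun i : Fin 6 => hB.eigenvalues i < 0).card = 3 ∧
        ((Finset.univ.filter fun i : Fin 6 => 0 < hB.eigenvalues i).card : ℤ)
            - ((Finset.univ.filter fun i : Fin 6 => hB.eigenvalues i < 0).card : ℤ) = 0) := by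
  refine ⟨fun m n hm hn => ?_, fun m n hm hn ω h0 h1 => ?_⟩
  · have hs : 2 - 2 * Real.cos (4 * Real.pi * (1 / 4)) = 4 := by
      rw [show 4 * Real.pi * (1 / 4) = Real.pi by ring, Real.cos_pi]; norm_num
    have hadd := one_sub_exp_add_star (1 / 4)
    have hmul := one_sub_exp_mul_star (1 / 4)
    rw [hs] at hadd hmul
    have hm' : (1 : ℝ) ≤ m := by exact_mod_cast hm
    rw [Bmat_eq_hermitianForm]
    refine ⟨?_, ?_, isHermitian_hermitianForm m n _,
      card_eigenvalues_hermitianForm hadd hmul (by norm_num) hm hn (by linarith)⟩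
    · rw [det_hermitianForm hadd hmul]
      push_cast
      ring
    · have : 0 ≤ (53 * m - 17) * n := mul_nonneg (by linarith) hn
      exact_mod_cast (by linarith : (-64) * (53 + 4 * (53 * m - 17) * n) < 0)
  · set s := 2 - 2 * Real.cos (4 * Real.pi * ω) with hs_def
    have hπ := Real.pi_pos
    have hcos : Real.cos (4 * Real.pi * ω) < 1 := by
      refine lt_of_le_of_ne (Real.cos_le_one _) fun h => ?_
      have := (Real.cos_eq_one_iff_of_lt_of_lt (x := 4 * Real.pi * ω) ?_ ?_).mp h
      · exact (by positivity : 4 * Real.pi * ω ≠ 0) this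
      all_goals nlinarith
    have hs : 0 < s := by linarith
    have hm' : (7 : ℝ) ≤ m := by exact_mod_cast hm
    have hM : 4 * s + 1 < m * (4 * s ^ 2 - 3 * s + 1) := by
      have hq : 0 < 4 * s ^ 2 - 3 * s + 1 := by nlinarith [sq_nonneg (8 * s - 3)]
      nlinarith [sq_nonneg (56 * s - 25)]
    have hadd := one_sub_exp_add_star ω
    have hmul := one_sub_exp_mul_star ω
    rw [← hs_def] at hadd hmul
    rw [Bmat_eq_hermitianForm]
    obtain ⟨hpos, hneg⟩ :=
      card_eigenvalues_hermitianForm hadd hmul hs (by linarith) hn hM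
    exact ⟨⟨_, det_hermitianForm_factor_neg hn hs hM, det_hermitianForm hadd hmul⟩,
      isHermitian_hermitianForm m n _, hpos, hneg, by rw [hpos, hneg, sub_self]⟩
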